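/- Let G(x,Γ) be a Goppa code of order r ≥ q−1 over F_q with extension degree m > 1, and let C = GRS_r(x,y) where y_i = 1/Γ(x_i). Then for any non-negative integer e ≤ ⌊m/2⌋, ((G(x,Γ))^⊥)^{⋆2} ⊆ B_e + Σ_{u=e+1}^{⌊m/2⌋} Tr(C ⋆ C^{q^u}). -/

import Mathlib

open Finset Polynomial

noncomputable section

/-- Componentwise (Schur) product of two linear codes of length `n` over `F`:
the `F`-linear span of `{c ⋆ d : c ∈ C, d ∈ D}`. -/
def schurProd {F : Type*} [Field F] {n : ℕ} (C D : Submodule F (Fin n → F)) :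
    Submodule F (Fin n → F) :=
  Submodule.span F {v | ∃ c ∈ C, ∃ d ∈ D, v = c * d}

/-- Dual code with respect to the standard bilinear form `⟨u,v⟩ = ∑ i, u i * v i`. -/
def dualCode {F : Type*} [Field F] {n : ℕ} (C : Submodule F (Fin n → F)) :
    Submodule F (Fin n → F) where
  carrier := {v | ∀ c ∈ C, ∑ i, v i * c i = 0}
  add_mem' := by
    intro a b ha hb c hc
    simp only [Set.mem_setOf_eq] at *
    simp [Pi.add_apply, add_mul, Finset.sum_add_distrib, ha c hc, hb c hc]
  zero_mem' := by
    intro c hc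
    simp
  smul_mem' := by
    intro t a ha c hc
    simp only [Set.mem_setOf_eq] at *
    simp [Pi.smul_apply, smul_eq_mul, mul_assoc, ← Finset.mul_sum, ha c hc]

/-- Image of a code under the componentwise `t`-th power map (as the span of the
image set, which is a linear code). For `t = q^i` this is `C^{q^i}`. -/
def powCode {F : Type*} [Field F] {n : ℕ} (t : ℕ) (C : Submodule F (Fin n → F)) :
    Submodule F (Fin n → F) :=
  Submodule.span F ((fun c : Fin n → F => fun j => c j ^ t) '' C)

/-- Generalized Reed–Solomon code of dimension `r`, support `x` and multiplier `y`. -/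
def GRSCode {F : Type*} [Field F] {n : ℕ} (r : ℕ) (x y : Fin n → F) :
    Submodule F (Fin n → F) :=
  Submodule.span F
    {v | ∃ P : F[X], P.degree < (r : WithBot ℕ) ∧ v = fun i => y i * P.eval (x i)}

variable (Fq Fqm : Type*) [Field Fq] [Field Fqm] [Algebra Fq Fqm]

/-- The componentwise trace map `F_{q^m}^n → F_q^n`, as an `F_q`-linear map. -/
def trVecLM (n : ℕ) : (Fin n → Fqm) →ₗ[Fq] (Fin n → Fq) :=
  LinearMap.pi fun i => (Algebra.trace Fq Fqm).comp (LinearMap.proj i)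

/-- The trace code `Tr(C)` of an `F_{q^m}`-linear code `C`. -/
def traceCode {n : ℕ} (C : Submodule Fqm (Fin n → Fqm)) : Submodule Fq (Fin n → Fq) :=
  Submodule.map (trVecLM Fq Fqm n) (C.restrictScalars Fq)

/-- The componentwise inclusion `F_q^n → F_{q^m}^n`, as an `F_q`-linear map. -/
def algVecLM (n : ℕ) : (Fin n → Fq) →ₗ[Fq] (Fin n → Fqm) :=
  LinearMap.pi fun i => (Algebra.linearMap Fq Fqm).comp (LinearMap.proj i)

/-- The alternant code `Alt_r(x,y) = GRS_r(x,y)^⊥ ∩ F_q^n`, a code over `F_q`. -/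
def AltCode {n : ℕ} (r : ℕ) (x y : Fin n → Fqm) : Submodule Fq (Fin n → Fq) :=
  Submodule.comap (algVecLM Fq Fqm n) ((dualCode (GRSCode r x y)).restrictScalars Fq)

/-- The codes `B_v`: `B_0 = Alt_{2r-1}(x, y^2)^⊥` and
`B_v = Alt_{r(q^v - q^{v-1} + 1)}(x, y^{q^v+1})^⊥` for `v ≥ 1`. -/
def BCode (q : ℕ) {n : ℕ} (r : ℕ) (x y : Fin n → Fqm) : ℕ → Submodule Fq (Fin n → Fq)
  | 0 => dualCode (AltCode Fq Fqm (2 * r - 1) x fun i => y i ^ 2)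
  | (v + 1) =>
      dualCode (AltCode Fq Fqm (r * (q ^ (v + 1) - q ^ v + 1)) x
        fun i => y i ^ (q ^ (v + 1) + 1))

end

section Delsarte

variable {Fq Fqm : Type*} [Field Fq] [Field Fqm] [Algebra Fq Fqm] {n : ℕ}

@[simp] lemma trVecLM_apply (f : Fin n → Fqm) (i : Fin n) :
    trVecLM Fq Fqm n f i = Algebra.trace Fq Fqm (f i) := rfl

lemma mem_GRSCode {F : Type*} [Field F] {r : ℕ} {x y v : Fin n → F} :
    v ∈ GRSCode r x y ↔
      ∃ P : F[X], P.degree < (r : WithBot ℕ) ∧ v = fun i => y i * P.eval (x i) := by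
  refine ⟨fun h => ?_, fun h => Submodule.subset_span h⟩
  induction h using Submodule.span_induction with
  | mem v hv => exact hv
  | zero => exact ⟨0, by simp, by ext; simp⟩
  | add u v _ _ hu hv =>
    obtain ⟨P, hP, rfl⟩ := hu
    obtain ⟨Q, hQ, rfl⟩ := hv
    exact ⟨P + Q, (degree_add_le P Q).trans_lt (max_lt hP hQ), by ext; simp [mul_add]⟩
  | smul a v _ hv =>
    obtain ⟨P, hP, rfl⟩ := hv
    exact ⟨a • P, (degree_smul_le a P).trans_lt hP, by ext; simp [mul_left_comm]⟩

lemma exists_natDegree_lt_of_mem_GRSCode {F : Type*} [Field F] {r : ℕ} (hr : 0 < r)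
    {x y v : Fin n → F} (hv : v ∈ GRSCode r x y) :
    ∃ P : F[X], P.natDegree < r ∧ ∀ i, v i = y i * P.eval (x i) := by
  obtain ⟨P, hP, rfl⟩ := mem_GRSCode.1 hv
  refine ⟨P, ?_, fun _ => rfl⟩
  rcases eq_or_ne P 0 with rfl | h0
  · simpa using hr
  · exact (natDegree_lt_iff_degree_lt h0).2 hP

lemma trVecLM_mem_traceCode_GRSCode {k : ℕ} {x z f : Fin n → Fqm} {P : Fqm[X]}
    (hP : P.natDegree < k) (hf : ∀ i, f i = z i * P.eval (x i)) :
    trVecLM Fq Fqm n f ∈ traceCode Fq Fqm (GRSCode k x z) :=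
  Submodule.mem_map_of_mem <| mem_GRSCode.2
    ⟨P, degree_le_natDegree.trans_lt (WithBot.coe_lt_coe.2 hP), funext hf⟩

/-- Double orthogonality for the standard bilinear form. -/
lemma mem_of_forall_dotProduct_eq_zero {F : Type*} [Field F] {D : Submodule F (Fin n → F)}
    {v : Fin n → F} (h : ∀ c : Fin n → F, (∀ d ∈ D, ∑ i, c i * d i = 0) → ∑ i, v i * c i = 0) :
    v ∈ D := by
  by_contra hv
  obtain ⟨f, hfv, hf⟩ := Submodule.exists_le_ker_of_notMem hv
  have key (w : Fin n → F) : f w = ∑ i, w i * f (fun j => if i = j then 1 else 0) := by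
    simpa using LinearMap.pi_apply_eq_sum_univ f w
  refine hfv ((key v).trans (h _ fun d hd => ?_))
  refine Eq.trans ?_ ((key d).symm.trans (LinearMap.mem_ker.1 (hf hd)))
  exact Finset.sum_congr rfl fun _ _ => mul_comm _ _

/-- Delsarte's theorem: the dual of a subfield subcode is the trace of the dual. -/
lemma dualCode_AltCode [Finite Fq] [Finite Fqm] (r : ℕ) (x y : Fin n → Fqm) :
    dualCode (AltCode Fq Fqm r x y) = traceCode Fq Fqm (GRSCode r x y) := by
  have tr_dot (c : Fin n → Fq) (d : Fin n → Fqm) :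
      ∑ i, c i * trVecLM Fq Fqm n d i =
        Algebra.trace Fq Fqm (∑ i, algebraMap Fq Fqm (c i) * d i) := by
    rw [map_sum]
    refine Finset.sum_congr rfl fun i _ => ?_
    rw [← Algebra.smul_def, map_smul, smul_eq_mul, trVecLM_apply]
  apply le_antisymm
  · intro v hv
    refine mem_of_forall_dotProduct_eq_zero fun c hc => hv c ?_
    intro d hd
    have hnd := (traceForm_nondegenerate Fq Fqm).1
    refine hnd _ fun a => ?_
    have := hc _ (Submodule.mem_map_of_mem (f := trVecLM Fq Fqm n)
      (show a • d ∈ (GRSCode r x y).restrictScalars Fq from Submodule.smul_mem _ a hd))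
    rw [tr_dot] at this
    rw [Algebra.traceForm_apply, ← this, Finset.sum_mul]
    congr 1
    refine Finset.sum_congr rfl fun i _ => ?_
    simp only [Pi.smul_apply, smul_eq_mul]
    change algebraMap Fq Fqm (c i) * d i * a = _
    ring
  · rintro _ ⟨d, hd, rfl⟩ c hc
    have h0 : ∑ i, algebraMap Fq Fqm (c i) * d i = 0 := hc d hd
    simp_rw [mul_comm _ (c _)]
    rw [tr_dot, h0, map_zero]

end Delsarte

lemma Polynomial.exists_eq_mul_add_natDegree {F : Type*} [Field F] {G : F[X]}
    (hG : G.natDegree ≠ 0) (R : F[X]) :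
    ∃ A B : F[X], R = G * A + B ∧ B.natDegree < G.natDegree ∧
      A.natDegree ≤ R.natDegree - G.natDegree := by
  refine ⟨R / G, R % G, (EuclideanDomain.div_add_mod R G).symm, natDegree_mod_lt R hG, ?_⟩
  have hG0 : G ≠ 0 := by rintro rfl; simp at hG
  rcases lt_or_ge R.degree G.degree with h | h
  · rw [(Polynomial.div_eq_zero_iff hG0).2 h]; simp
  · have h1 := degree_add_div hG0 h
    rcases eq_or_ne (R / G) 0 with h0 | h0
    · simp [h0]
    have hR0 : R ≠ 0 := by
      rintro rfl
      simp at h0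
    rw [degree_eq_natDegree hG0, degree_eq_natDegree h0, degree_eq_natDegree hR0] at h1
    have : G.natDegree + (R / G).natDegree = R.natDegree := by exact_mod_cast h1
    omega

lemma pow_eq_pow_mul_pow_sub_of_mul_eq_one {M : Type*} [CommMonoid M] {y g : M} (h : y * g = 1)
    {a b : ℕ} (hab : a ≤ b) : y ^ a = y ^ b * g ^ (b - a) := by
  obtain ⟨c, rfl⟩ := Nat.exists_eq_add_of_le hab
  rw [Nat.add_sub_cancel_left, pow_add, mul_assoc, ← mul_pow, h, one_pow, mul_one]

section Frobenius

variable {Fq Fqm : Type*} [Field Fq] [Field Fqm] [Algebra Fq Fqm] [Fintype Fq]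

lemma add_pow_card_pow (a b : Fqm) (k : ℕ) :
    (a + b) ^ Fintype.card Fq ^ k = a ^ Fintype.card Fq ^ k + b ^ Fintype.card Fq ^ k := by
  induction k with
  | zero => simp
  | succ k ih =>
    simp only [pow_succ, pow_mul, ih]
    exact map_add (FiniteField.frobeniusAlgHom Fq Fqm) _ _

lemma trace_pow_card [Finite Fqm] (a : Fqm) :
    Algebra.trace Fq Fqm (a ^ Fintype.card Fq) = Algebra.trace Fq Fqm a :=
  Algebra.trace_eq_of_algEquiv (AlgEquiv.ofBijective (FiniteField.frobeniusAlgHom Fq Fqm)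
    (Finite.injective_iff_bijective.1 (FiniteField.frobeniusAlgHom Fq Fqm).toRingHom.injective)) a

lemma trace_pow_card_pow [Finite Fqm] (a : Fqm) (k : ℕ) :
    Algebra.trace Fq Fqm (a ^ Fintype.card Fq ^ k) = Algebra.trace Fq Fqm a := by
  induction k with
  | zero => simp
  | succ k ih => rw [pow_succ, pow_mul, trace_pow_card, ih]

lemma trVecLM_pow_card [Finite Fqm] {n : ℕ} {f g : Fin n → Fqm}
    (h : ∀ i, g i = f i ^ Fintype.card Fq) : trVecLM Fq Fqm n f = trVecLM Fq Fqm n g := by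
  ext i
  rw [trVecLM_apply, trVecLM_apply, h, trace_pow_card]

/-- The product of two traces as a sum of traces of products with Frobenius conjugates. -/
lemma trace_mul_trace [Finite Fqm] (a b : Fqm) :
    Algebra.trace Fq Fqm a * Algebra.trace Fq Fqm b =
      ∑ u ∈ Finset.range (Module.finrank Fq Fqm),
        Algebra.trace Fq Fqm (a * b ^ Fintype.card Fq ^ u) := by
  rw [mul_comm, ← smul_eq_mul, ← map_smul, Algebra.smul_def,
    FiniteField.algebraMap_trace_eq_sum_pow, Finset.sum_mul, map_sum, Nat.card_eq_fintype_card]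
  simp_rw [mul_comm a]

end Frobenius

section Goppa

variable {Fq Fqm : Type*} [Field Fq] [Field Fqm] [Algebra Fq Fqm] [Fintype Fq] [Finite Fqm]
  {n r : ℕ} {x y : Fin n → Fqm} {Γ : Fqm[X]}

local notation "q" => Fintype.card Fq

lemma trVecLM_mem_BCode_zero {f : Fin n → Fqm} {P : Fqm[X]} (hP : P.natDegree < 2 * r - 1)
    (hf : ∀ i, f i = y i ^ 2 * P.eval (x i)) :
    trVecLM Fq Fqm n f ∈ BCode Fq Fqm q r x y 0 := by
  rw [BCode, dualCode_AltCode]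
  exact trVecLM_mem_traceCode_GRSCode hP hf

lemma trVecLM_mem_BCode_succ {v : ℕ} {f : Fin n → Fqm} {P : Fqm[X]}
    (hP : P.natDegree < r * (q ^ (v + 1) - q ^ v + 1))
    (hf : ∀ i, f i = y i ^ (q ^ (v + 1) + 1) * P.eval (x i)) :
    trVecLM Fq Fqm n f ∈ BCode Fq Fqm q r x y (v + 1) := by
  rw [BCode, dualCode_AltCode]
  exact trVecLM_mem_traceCode_GRSCode hP hf

lemma trVecLM_mul_eval_mem_BCode_one (hr : 0 < r) (hΓ : Γ.natDegree = r)
    (hy : ∀ i, y i * Γ.eval (x i) = 1) (R : Fqm[X]) (hR : R.natDegree < r) :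
    trVecLM Fq Fqm n (fun i => y i * R.eval (x i)) ∈ BCode Fq Fqm q r x y 1 := by
  induction hd : R.natDegree using Nat.strong_induction_on generalizing R with
  | _ d ih =>
  have hq : 1 < q := Fintype.one_lt_card
  obtain ⟨s, hs⟩ : ∃ s, q = s + 2 := ⟨q - 2, by omega⟩
  have small (B : Fqm[X]) (hB : B.natDegree < r * (q - 1)) :
      trVecLM Fq Fqm n (fun i => y i ^ q * B.eval (x i)) ∈ BCode Fq Fqm q r x y 1 := by
    refine trVecLM_mem_BCode_succ (P := Γ * B) ?_ fun i => ?_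
    · refine natDegree_mul_le.trans_lt ?_
      rw [hΓ]
      simp only [zero_add, pow_one, pow_zero]
      rw [mul_add, mul_one]
      omega
    · rw [eval_mul, zero_add, pow_one, pow_succ]
      linear_combination (-(y i ^ q * B.eval (x i))) * hy i
  have hfrob : trVecLM Fq Fqm n (fun i => y i * R.eval (x i)) =
      trVecLM Fq Fqm n (fun i => y i ^ q * (R ^ q).eval (x i)) :=
    trVecLM_pow_card fun i => by rw [eval_pow, mul_pow]
  have hRq : (R ^ q).natDegree = q * d := by rw [natDegree_pow, hd]
  by_cases hlt : q * d < r * (q - 1)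
  · rw [hfrob]
    exact small _ (hRq ▸ hlt)
  have hG : (Γ ^ (q - 1)).natDegree = r * (q - 1) := by rw [natDegree_pow, hΓ, mul_comm]
  have hpos : 0 < r * (q - 1) := Nat.mul_pos hr (by omega)
  obtain ⟨A, B, hAB, hB, hA⟩ := exists_eq_mul_add_natDegree (hG ▸ hpos.ne') (R ^ q)
  rw [hG] at hB hA
  rw [hRq] at hA
  have hAd : A.natDegree < d := by
    have h1 : 0 < d := by
      rcases Nat.eq_zero_or_pos d with rfl | h
      · simp at hlt; omega
      · exact h
    have h2 : d * (q - 1) < r * (q - 1) := Nat.mul_lt_mul_of_pos_right (hd ▸ hR) (by omega)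
    have h3 : q * d = d * (q - 1) + d := by rw [hs]; simp; ring
    omega
  have hsum : trVecLM Fq Fqm n (fun i => y i * R.eval (x i)) =
      trVecLM Fq Fqm n (fun i => y i * A.eval (x i)) +
        trVecLM Fq Fqm n (fun i => y i ^ q * B.eval (x i)) := by
    rw [hfrob, hAB, ← map_add]
    congr 1
    ext i
    have h := pow_eq_pow_mul_pow_sub_of_mul_eq_one (hy i) hq.le
    rw [pow_one] at h
    simp only [eval_add, eval_mul, eval_pow, Pi.add_apply]
    linear_combination (-(A.eval (x i))) * h
  rw [hsum]
  exact add_mem (ih _ hAd A (by omega) rfl) (small B hB)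

lemma BCode_le_BCode_succ (hr : 0 < r) (hΓ : Γ.natDegree = r)
    (hy : ∀ i, y i * Γ.eval (x i) = 1) (v : ℕ) :
    BCode Fq Fqm q r x y v ≤ BCode Fq Fqm q r x y (v + 1) := by
  have hq : 1 < q := Fintype.one_lt_card
  have remainder (v : ℕ) (B : Fqm[X]) (hB : B.natDegree < r) :
      trVecLM Fq Fqm n (fun i => y i ^ (q ^ v + 1) * B.eval (x i)) ∈
        BCode Fq Fqm q r x y (v + 1) := by
    have hle : q ^ v ≤ q ^ (v + 1) := Nat.pow_le_pow_right (by omega) (by omega)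
    refine trVecLM_mem_BCode_succ (P := Γ ^ (q ^ (v + 1) - q ^ v) * B) ?_ fun i => ?_
    · refine natDegree_mul_le.trans_lt ?_
      rw [natDegree_pow, hΓ, mul_add, mul_one, mul_comm r]
      omega
    · rw [pow_eq_pow_mul_pow_sub_of_mul_eq_one (hy i) (Nat.succ_le_succ hle),
        Nat.succ_sub_succ, eval_mul, eval_pow, mul_assoc]
  have split (v : ℕ) (A B : Fqm[X]) :
      trVecLM Fq Fqm n (fun i => y i ^ (q ^ v + 1) * (Γ * A + B).eval (x i)) =
        trVecLM Fq Fqm n (fun i => y i ^ q ^ v * A.eval (x i)) +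
          trVecLM Fq Fqm n (fun i => y i ^ (q ^ v + 1) * B.eval (x i)) := by
    rw [← map_add]
    congr 1
    ext i
    simp only [eval_add, eval_mul, Pi.add_apply, pow_succ (y i)]
    linear_combination (y i ^ q ^ v * A.eval (x i)) * hy i
  cases v with
  | zero =>
    rw [BCode, dualCode_AltCode]
    rintro _ ⟨w, hw, rfl⟩
    obtain ⟨R, hR, hwR⟩ := exists_natDegree_lt_of_mem_GRSCode (by omega) hw
    obtain ⟨A, B, rfl, hB, hA⟩ := exists_eq_mul_add_natDegree (hΓ ▸ hr.ne') R
    rw [hΓ] at hB hA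
    obtain rfl := funext hwR
    have h := split 0 A B
    rw [pow_zero] at h
    rw [show (2 : ℕ) = 1 + 1 from rfl, h]
    refine add_mem ?_ (remainder 0 B hB)
    simp only [pow_one]
    exact trVecLM_mul_eval_mem_BCode_one hr hΓ hy A (by omega)
  | succ v =>
    rw [BCode, dualCode_AltCode]
    rintro _ ⟨w, hw, rfl⟩
    obtain ⟨R, hR, hwR⟩ := exists_natDegree_lt_of_mem_GRSCode (Nat.mul_pos hr (by omega)) hw
    obtain ⟨A, B, rfl, hB, hA⟩ := exists_eq_mul_add_natDegree (hΓ ▸ hr.ne') R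
    rw [hΓ] at hB hA
    obtain rfl := funext hwR
    rw [split (v + 1) A B]
    refine add_mem ?_ (remainder (v + 1) B hB)
    have hlt : q ^ v < q ^ (v + 1) := Nat.pow_lt_pow_right hq (by omega)
    have hpos : 0 < r * (q ^ (v + 1) - q ^ v) := Nat.mul_pos hr (by omega)
    have hA' : A.natDegree < r * (q ^ (v + 1) - q ^ v) := by
      rw [mul_add, mul_one] at hR
      omega
    rw [trVecLM_pow_card (g := fun i => y i ^ q ^ (v + 2) * (A ^ q).eval (x i)) fun i => by
      rw [eval_pow, mul_pow, ← pow_mul, ← pow_succ]]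
    refine trVecLM_mem_BCode_succ (P := Γ * A ^ q) ?_ fun i => ?_
    · refine natDegree_mul_le.trans_lt ?_
      rw [natDegree_pow, hΓ]
      have h1 : q * A.natDegree < q * (r * (q ^ (v + 1) - q ^ v)) :=
        Nat.mul_lt_mul_of_pos_left hA' (by omega)
      have h2 : q * (r * (q ^ (v + 1) - q ^ v)) = r * (q ^ (v + 1 + 1) - q ^ (v + 1)) := by
        rw [pow_succ q (v + 1), pow_succ q v, ← Nat.sub_mul]
        ring
      rw [mul_add, mul_one]
      omega
    · rw [eval_mul, pow_succ (y i)]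
      linear_combination (-(y i ^ q ^ (v + 2) * (A ^ q).eval (x i))) * hy i

lemma BCode_mono (hr : 0 < r) (hΓ : Γ.natDegree = r) (hy : ∀ i, y i * Γ.eval (x i) = 1) :
    Monotone (BCode Fq Fqm q r x y) :=
  monotone_nat_of_le_succ (BCode_le_BCode_succ hr hΓ hy)

lemma trVecLM_mul_pow_mem_BCode (hr : 0 < r) (hΓ : Γ.natDegree = r)
    (hy : ∀ i, y i * Γ.eval (x i) = 1) (u : ℕ) (P Q : Fqm[X]) (hP : P.natDegree < r)
    (hQ : Q.natDegree < r) :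
    trVecLM Fq Fqm n (fun i => y i * P.eval (x i) * (y i * Q.eval (x i)) ^ q ^ u) ∈
      BCode Fq Fqm q r x y u := by
  have hq : 1 < q := Fintype.one_lt_card
  induction u generalizing Q with
  | zero =>
    refine trVecLM_mem_BCode_zero (P := P * Q) ?_ fun i => ?_
    · refine natDegree_mul_le.trans_lt ?_
      omega
    · rw [eval_mul]
      ring
  | succ u ih =>
    have hG : (Γ ^ (q - 1)).natDegree = r * (q - 1) := by rw [natDegree_pow, hΓ, mul_comm]
    have hpos : 0 < r * (q - 1) := Nat.mul_pos hr (by omega)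
    obtain ⟨A, B, hAB, hB, hA⟩ := exists_eq_mul_add_natDegree (hG ▸ hpos.ne') (Q ^ q)
    rw [hG] at hB hA
    rw [natDegree_pow] at hA
    have hAr : A.natDegree < r := by
      have h1 : q * Q.natDegree < q * r := Nat.mul_lt_mul_of_pos_left hQ (by omega)
      have h2 : q * r = r * (q - 1) + r := by
        obtain ⟨s, hs⟩ : ∃ s, q = s + 1 := ⟨q - 1, by omega⟩
        rw [hs]; simp; ring
      omega
    have hsum : trVecLM Fq Fqm n
          (fun i => y i * P.eval (x i) * (y i * Q.eval (x i)) ^ q ^ (u + 1)) =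
        trVecLM Fq Fqm n (fun i => y i * P.eval (x i) * (y i * A.eval (x i)) ^ q ^ u) +
          trVecLM Fq Fqm n
            (fun i => y i ^ (q ^ (u + 1) + 1) * (P * B ^ q ^ u).eval (x i)) := by
      rw [← map_add]
      congr 1
      ext i
      have h := pow_eq_pow_mul_pow_sub_of_mul_eq_one (hy i) hq.le
      rw [pow_one] at h
      have h1 : (y i * Q.eval (x i)) ^ q = y i * A.eval (x i) + y i ^ q * B.eval (x i) := by
        rw [mul_pow, ← eval_pow, hAB]
        simp only [eval_add, eval_mul, eval_pow]
        linear_combination (-(A.eval (x i))) * h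
      rw [Pi.add_apply, pow_succ' q u, pow_mul, h1, add_pow_card_pow, eval_mul, eval_pow,
        pow_succ (y i), pow_mul (y i)]
      ring
    rw [hsum]
    refine add_mem (BCode_le_BCode_succ hr hΓ hy u (ih A hAr)) ?_
    refine trVecLM_mem_BCode_succ ?_ fun i => rfl
    refine natDegree_mul_le.trans_lt ?_
    rw [natDegree_pow]
    have h1 : q ^ u * B.natDegree ≤ q ^ u * (r * (q - 1)) := Nat.mul_le_mul_left _ hB.le
    have h2 : q ^ u * (r * (q - 1)) = r * (q ^ (u + 1) - q ^ u) := by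
      rw [pow_succ, ← Nat.mul_sub_one]
      ring
    rw [mul_add, mul_one]
    omega

end Goppa

/-- For a Goppa code `G(x,Γ) = Alt_r(x,y)` (with `y_i = 1/Γ(x_i)`)
of order `r ≥ q−1` over `F_q`, extension degree `m > 1`, `C = GRS_r(x,y)` and any
`e ≤ ⌊m/2⌋`: `((G(x,Γ))^⊥)^{⋆2} ⊆ B_e + ∑_{u=e+1}^{⌊m/2⌋} Tr(C ⋆ C^{q^u})`. -/
theorem sq_dual_goppa_le_BCode_sup_sum
    (q m n : ℕ) (hm : 1 < m)
    (Fq Fqm : Type*) [Field Fq] [Field Fqm] [Algebra Fq Fqm]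
    [Fintype Fq] [Fintype Fqm]
    (hq : Fintype.card Fq = q) (hqm : Fintype.card Fqm = q ^ m)
    (r : ℕ) (hr : q - 1 ≤ r) (Γ : Polynomial Fqm) (hΓ : Γ.degree = (r : WithBot ℕ))
    (x : Fin n → Fqm) (hx : Function.Injective x) (hΓx : ∀ i, Γ.eval (x i) ≠ 0)
    (y : Fin n → Fqm) (hy : ∀ i, y i = (Γ.eval (x i))⁻¹)
    (e : ℕ) (he : e ≤ m / 2) :
    schurProd (dualCode (AltCode Fq Fqm r x y)) (dualCode (AltCode Fq Fqm r x y)) ≤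
      BCode Fq Fqm q r x y e ⊔
        ∑ u ∈ Finset.Icc (e + 1) (m / 2),
          traceCode Fq Fqm (schurProd (GRSCode r x y) (powCode (q ^ u) (GRSCode r x y))) := by
  subst hq
  have hr0 : 0 < r := by
    have : 1 < Fintype.card Fq := Fintype.one_lt_card
    omega
  have hΓ' : Γ.natDegree = r := natDegree_eq_of_degree_eq_some hΓ
  have hy' : ∀ i, y i * Γ.eval (x i) = 1 := fun i => by rw [hy, inv_mul_cancel₀ (hΓx i)]
  have hfin : Module.finrank Fq Fqm = m :=
    Nat.pow_right_injective Fintype.one_lt_card (Module.card_eq_pow_finrank.symm.trans hqm)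
  have low (u : ℕ) (hu : u ≤ m / 2) (a b : Fin n → Fqm) (ha : a ∈ GRSCode r x y)
      (hb : b ∈ GRSCode r x y) :
      trVecLM Fq Fqm n (fun i => a i * b i ^ Fintype.card Fq ^ u) ∈
        BCode Fq Fqm (Fintype.card Fq) r x y e ⊔
          ∑ u ∈ Finset.Icc (e + 1) (m / 2), traceCode Fq Fqm
            (schurProd (GRSCode r x y) (powCode (Fintype.card Fq ^ u) (GRSCode r x y))) := by
    rcases le_or_gt u e with hue | hue
    · obtain ⟨P, hP, haP⟩ := exists_natDegree_lt_of_mem_GRSCode hr0 ha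
      obtain ⟨Q, hQ, hbQ⟩ := exists_natDegree_lt_of_mem_GRSCode hr0 hb
      obtain rfl := funext haP
      obtain rfl := funext hbQ
      exact Submodule.mem_sup_left
        (BCode_mono hr0 hΓ' hy' hue (trVecLM_mul_pow_mem_BCode hr0 hΓ' hy' u P Q hP hQ))
    · refine Submodule.mem_sup_right
        ((Finset.single_le_sum (f := fun u => traceCode Fq Fqm
          (schurProd (GRSCode r x y) (powCode (Fintype.card Fq ^ u) (GRSCode r x y))))
          (fun _ _ => bot_le) (Finset.mem_Icc.2 ⟨hue, hu⟩)) ?_)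
      exact Submodule.mem_map_of_mem (Submodule.subset_span
        ⟨a, ha, _, Submodule.subset_span ⟨b, hb, rfl⟩, rfl⟩)
  rw [dualCode_AltCode]
  refine Submodule.span_le.2 ?_
  rintro _ ⟨_, ⟨a, ha, rfl⟩, _, ⟨b, hb, rfl⟩, rfl⟩
  have hprod : trVecLM Fq Fqm n a * trVecLM Fq Fqm n b =
      ∑ u ∈ Finset.range m, trVecLM Fq Fqm n (fun i => a i * b i ^ Fintype.card Fq ^ u) := by
    ext i
    rw [Pi.mul_apply, Finset.sum_apply, trVecLM_apply, trVecLM_apply, trace_mul_trace, hfin]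
    rfl
  rw [hprod]
  refine sum_mem fun u hu => ?_
  rcases le_or_gt u (m / 2) with hum | hum
  · exact low u hum a b ha hb
  · have hu' := Finset.mem_range.1 hu
    have hswap : trVecLM Fq Fqm n (fun i => a i * b i ^ Fintype.card Fq ^ u) =
        trVecLM Fq Fqm n (fun i => b i * a i ^ Fintype.card Fq ^ (m - u)) := by
      ext i
      rw [trVecLM_apply, trVecLM_apply, ← trace_pow_card_pow _ (m - u), mul_pow, ← pow_mul,
        ← pow_add, Nat.add_sub_cancel' hu'.le, ← hqm, FiniteField.pow_card, mul_comm]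
    rw [hswap]
    exact low (m - u) (by omega) b a hb ha
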